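/- Exact first and second central moments of the number of order-2 branches: for every integer n ≥ 2, ⟨S_{2,n} − n/4⟩ = n/(4(2n−3)), and for every integer n ≥ 4, ⟨(S_{2,n} − n/4)²⟩ = n(4n²−17n+16)/(16(2n−3)(2n−5)). -/

import Mathlib

open MeasureTheory ProbabilityTheory Filter
open scoped NNReal Topology

/-- Binary trees: every internal node has exactly two children. -/
inductive BinTree : Type
  | leaf : BinTree
  | node : BinTree → BinTree → BinTree
  deriving DecidableEq

namespace BinTree

/-- The magnitude of a binary tree is its number of leaves. -/
def magnitude : BinTree → ℕ
  | leaf => 1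
  | node l r => magnitude l + magnitude r

/-- The Horton–Strahler order of (the root of) a binary tree:
leaves have order 1; a node whose two children have distinct orders has the max of the two;
a node whose two children have equal order `r` has order `r + 1`. -/
def ord : BinTree → ℕ
  | leaf => 1
  | node l r => if ord l = ord r then ord l + 1 else max (ord l) (ord r)

/-- `branches k τ` is `S_{k,n}(τ)`, the number of Horton–Strahler branches of order `k`
in `τ`, i.e. the number of maximal connected paths of nodes of order `k`.  It counts the
nodes of order `k` that head a branch: a new branch head of order `ord l + 1` is created
exactly at a node whose two children have equal order `ord l`, and every leaf heads an
order-1 branch. -/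
def branches (k : ℕ) : BinTree → ℕ
  | leaf => if k = 1 then 1 else 0
  | node l r => branches k l + branches k r +
      (if ord l = ord r ∧ ord l + 1 = k then 1 else 0)

end BinTree

/-- `treesOf n` is the finite set `Ω_n` of binary trees of magnitude `n`. -/
def treesOf : ℕ → Finset BinTree
  | 0 => ∅
  | 1 => {BinTree.leaf}
  | (n+2) => (Finset.range (n+1)).attach.biUnion fun k =>
      ((treesOf (k.1+1)) ×ˢ (treesOf (n+1-k.1))).image fun p => BinTree.node p.1 p.2
  decreasing_by
  · have := Finset.mem_range.mp k.2; omega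
  · omega

/-- Expectation `⟨f⟩` under the uniform probability measure `P_n` on `Ω_n` (the random model). -/
noncomputable def expect (n : ℕ) (f : BinTree → ℝ) : ℝ :=
  (∑ τ ∈ treesOf n, f τ) / (treesOf n).card

namespace BinTree

theorem ord_pos (τ : BinTree) : 1 ≤ ord τ := by
  induction τ with
  | leaf => simp [ord]
  | node l r hl hr => simp only [ord]; split_ifs <;> omega

theorem eq_leaf_of_ord_eq_one {τ : BinTree} (h : ord τ = 1) : τ = leaf := by
  cases τ with
  | leaf => rfl
  | node l r =>
    have hl := ord_pos l
    have hr := ord_pos r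
    simp only [ord] at h
    split_ifs at h <;> omega

end BinTree

section

open Finset BinTree

theorem magnitude_of_mem_treesOf {n : ℕ} {τ : BinTree} (h : τ ∈ treesOf n) :
    magnitude τ = n := by
  induction τ generalizing n with
  | leaf =>
    match n with
    | 0 => simp [treesOf] at h
    | 1 => rfl
    | n + 2 => simp [treesOf] at h
  | node l r hl hr =>
    match n with
    | 0 => simp [treesOf] at h
    | 1 => simp [treesOf] at h
    | n + 2 =>
      simp only [treesOf, mem_biUnion, mem_attach, mem_image, mem_product, true_and,
        Subtype.exists, mem_range, Prod.exists, node.injEq] at h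
      obtain ⟨k, hk, a, b, ⟨ha, hb⟩, rfl, rfl⟩ := h
      simp only [magnitude, hl ha, hr hb]
      omega

/-- Summation over binary trees by decomposition at the root. -/
theorem sum_treesOf {n : ℕ} (hn : n ≠ 1) (f : BinTree → ℝ) :
    ∑ τ ∈ treesOf n, f τ =
      ∑ p ∈ antidiagonal n, ∑ l ∈ treesOf p.1, ∑ r ∈ treesOf p.2, f (node l r) := by
  match n with
  | 0 => simp [treesOf]
  | 1 => exact absurd rfl hn
  | n + 2 =>
    rw [treesOf, sum_biUnion]
    · rw [Nat.antidiagonal_succ_succ', sum_cons, sum_cons, sum_map]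
      simp only [treesOf, sum_empty, sum_const_zero, zero_add]
      rw [Nat.sum_antidiagonal_eq_sum_range_succ_mk,
        sum_attach (range (n + 1)) fun k => ∑ τ ∈ (treesOf (k + 1) ×ˢ
          treesOf (n + 1 - k)).image fun p => node p.1 p.2, f τ]
      refine sum_congr rfl fun k hk => ?_
      rw [sum_image (by rintro ⟨a, b⟩ _ ⟨c, d⟩ _ h; simpa using h), sum_product]
      have : n + 1 - k = n - k + 1 := by have := mem_range.mp hk; omega
      simp [this]
    · intro i _ j _ hij
      refine disjoint_left.mpr fun τ hi hj => hij ?_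
      simp only [mem_image, mem_product, Prod.exists] at hi hj
      obtain ⟨a, b, ⟨ha, -⟩, rfl⟩ := hi
      obtain ⟨c, d, ⟨hc, -⟩, h⟩ := hj
      obtain ⟨rfl, rfl⟩ := node.inj h
      have h1 := magnitude_of_mem_treesOf ha
      have h2 := magnitude_of_mem_treesOf hc
      exact Subtype.ext (by omega)

theorem treesOf_two : treesOf 2 = {node leaf leaf} := by
  ext τ
  simp [treesOf, eq_comm]

theorem branches_two_node {n : ℕ} (hn : n ≠ 2) {p : ℕ × ℕ} (hp : p ∈ antidiagonal n)
    {l r : BinTree} (hl : l ∈ treesOf p.1) (hr : r ∈ treesOf p.2) :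
    branches 2 (node l r) = branches 2 l + branches 2 r := by
  rw [branches, if_neg, add_zero]
  rintro ⟨h, h'⟩
  have h1 : l = leaf := eq_leaf_of_ord_eq_one (by omega)
  have h2 : r = leaf := eq_leaf_of_ord_eq_one (by omega)
  subst h1 h2
  have h3 := magnitude_of_mem_treesOf hl
  have h4 := magnitude_of_mem_treesOf hr
  have h5 := mem_antidiagonal.mp hp
  simp only [magnitude] at h3 h4
  omega

theorem card_treesOf_succ (n : ℕ) : (treesOf (n + 1)).card = catalan n := by
  induction n using Nat.strong_induction_on with
  | _ n ih =>
    match n with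
    | 0 => simp [treesOf]
    | n + 1 =>
      have h := sum_treesOf (n := n + 2) (by omega) fun _ => 1
      rw [Nat.antidiagonal_succ_succ', sum_cons, sum_cons, sum_map] at h
      simp only [treesOf.eq_1, sum_const, nsmul_eq_mul, mul_one, card_empty, Nat.cast_zero,
        zero_mul, mul_zero, zero_add] at h
      rw [catalan_succ']
      have h' : ((treesOf (n + 2)).card : ℝ) =
          ((∑ p ∈ antidiagonal n, catalan p.1 * catalan p.2 : ℕ) : ℝ) := by
        rw [h]
        push_cast
        refine sum_congr rfl fun p hp => ?_
        have := mem_antidiagonal.mp hp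
        rw [← ih p.1 (by omega), ← ih p.2 (by omega)]
        rfl
      exact_mod_cast h'

/-- The generating function of the totals of `f` over the trees of each magnitude. -/
noncomputable def treeSeries (f : BinTree → ℝ) : PowerSeries ℝ :=
  PowerSeries.mk fun n => ∑ τ ∈ treesOf n, f τ

theorem coeff_treeSeries (f : BinTree → ℝ) (n : ℕ) :
    PowerSeries.coeff n (treeSeries f) = ∑ τ ∈ treesOf n, f τ :=
  PowerSeries.coeff_mk _ _

theorem coeff_treeSeries_mul (f g : BinTree → ℝ) (n : ℕ) :
    PowerSeries.coeff n (treeSeries f * treeSeries g) =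
      ∑ p ∈ antidiagonal n, ∑ l ∈ treesOf p.1, ∑ r ∈ treesOf p.2, f l * g r := by
  simp only [PowerSeries.coeff_mul, coeff_treeSeries, sum_mul_sum]

theorem treeSeries_one :
    treeSeries 1 = PowerSeries.X + treeSeries 1 ^ 2 := by
  ext n
  rw [map_add, sq, coeff_treeSeries_mul, PowerSeries.coeff_X, coeff_treeSeries]
  by_cases hn : n = 1
  · subst hn
    simp [treesOf, Nat.antidiagonal_succ]
  · simp [sum_treesOf hn, hn]

theorem treeSeries_branches_two :
    treeSeries (fun τ => branches 2 τ) = PowerSeries.X ^ 2 +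
      (treeSeries (fun τ => branches 2 τ) * treeSeries 1 +
        treeSeries 1 * treeSeries (fun τ => branches 2 τ)) := by
  ext n
  rw [map_add, map_add, coeff_treeSeries_mul, coeff_treeSeries_mul, PowerSeries.coeff_X_pow,
    coeff_treeSeries]
  by_cases h1 : n = 1
  · subst h1
    simp [treesOf, Nat.antidiagonal_succ, branches]
  by_cases h2 : n = 2
  · subst h2
    simp [treesOf_two, treesOf, Nat.antidiagonal_succ, branches, ord]
  rw [sum_treesOf h1, if_neg h2, zero_add, ← sum_add_distrib]
  refine sum_congr rfl fun p hp => ?_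
  simp only [← sum_add_distrib]
  refine sum_congr rfl fun l hl => sum_congr rfl fun r hr => ?_
  rw [branches_two_node h2 hp hl hr]
  simp

theorem treeSeries_branches_two_falling :
    treeSeries (fun τ => branches 2 τ * (branches 2 τ - 1)) =
      (treeSeries (fun τ => branches 2 τ * (branches 2 τ - 1)) * treeSeries 1 +
        treeSeries 1 * treeSeries (fun τ => branches 2 τ * (branches 2 τ - 1))) +
      (treeSeries (fun τ => branches 2 τ) * treeSeries (fun τ => branches 2 τ) +
        treeSeries (fun τ => branches 2 τ) * treeSeries (fun τ => branches 2 τ)) := by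
  ext n
  rw [map_add, map_add, map_add]
  simp only [coeff_treeSeries_mul, coeff_treeSeries]
  by_cases h1 : n = 1
  · subst h1
    simp [treesOf, Nat.antidiagonal_succ, branches]
  by_cases h2 : n = 2
  · subst h2
    simp [treesOf_two, treesOf, Nat.antidiagonal_succ, branches, ord]
  rw [sum_treesOf h1]
  simp only [← sum_add_distrib]
  refine sum_congr rfl fun p hp => sum_congr rfl fun l hl => sum_congr rfl fun r hr => ?_
  rw [branches_two_node h2 hp hl hr]
  push_cast
  simp only [Pi.one_apply]
  ring

theorem sum_branches_two_succ (m : ℕ) :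
    ∑ τ ∈ treesOf (m + 3), (branches 2 τ : ℝ) =
      4 * ∑ τ ∈ treesOf (m + 2), (branches 2 τ : ℝ) - 2 * catalan m := by
  have h : treeSeries (fun τ => branches 2 τ) +
      PowerSeries.X ^ 2 * (PowerSeries.C 2 * treeSeries 1) =
      PowerSeries.X ^ 2 + PowerSeries.X * (PowerSeries.C 4 * treeSeries fun τ => branches 2 τ) := by
    rw [map_ofNat, map_ofNat]
    linear_combination (1 - 2 * treeSeries 1) * treeSeries_branches_two
      + 4 * treeSeries (fun τ => branches 2 τ) * treeSeries_one
  have h' := congrArg (PowerSeries.coeff (m + 3)) h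
  rw [map_add, map_add, show m + 3 = (m + 1) + 2 from rfl, PowerSeries.coeff_X_pow_mul,
    show m + 1 + 2 = (m + 2) + 1 from rfl, PowerSeries.coeff_succ_X_mul, PowerSeries.coeff_X_pow,
    if_neg (by omega), PowerSeries.coeff_C_mul, PowerSeries.coeff_C_mul, coeff_treeSeries,
    coeff_treeSeries, coeff_treeSeries] at h'
  simp only [Pi.one_apply, sum_const, card_treesOf_succ, nsmul_eq_mul, mul_one] at h'
  linear_combination h'

theorem sum_branches_two_falling_succ (m : ℕ) :
    ∑ τ ∈ treesOf (m + 2), (branches 2 τ * (branches 2 τ - 1) : ℝ) =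
      4 * ∑ τ ∈ treesOf (m + 1), (branches 2 τ * (branches 2 τ - 1) : ℝ) +
        2 * ∑ τ ∈ treesOf m, (branches 2 τ : ℝ) := by
  have h : treeSeries (fun τ => branches 2 τ * (branches 2 τ - 1)) =
      PowerSeries.X * (PowerSeries.C 4 *
        treeSeries fun τ => branches 2 τ * (branches 2 τ - 1)) +
      PowerSeries.X ^ 2 * (PowerSeries.C 2 * treeSeries fun τ => branches 2 τ) := by
    rw [map_ofNat, map_ofNat]
    linear_combination (1 - 2 * treeSeries 1) * treeSeries_branches_two_falling
      + 4 * treeSeries (fun τ => branches 2 τ * (branches 2 τ - 1)) * treeSeries_one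
      + 2 * treeSeries (fun τ => branches 2 τ) * treeSeries_branches_two
  have h' := congrArg (PowerSeries.coeff (m + 2)) h
  rw [map_add, PowerSeries.coeff_X_pow_mul, PowerSeries.coeff_succ_X_mul,
    PowerSeries.coeff_C_mul, PowerSeries.coeff_C_mul, coeff_treeSeries,
    coeff_treeSeries, coeff_treeSeries] at h'
  exact h'

theorem cast_succ_mul_centralBinom_succ (m : ℕ) :
    ((m : ℝ) + 1) * (m + 1).centralBinom = 2 * (2 * m + 1) * m.centralBinom := by
  exact_mod_cast Nat.succ_mul_centralBinom_succ m

theorem cast_succ_mul_catalan (m : ℕ) :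
    ((m : ℝ) + 1) * catalan m = m.centralBinom := by
  exact_mod_cast succ_mul_catalan_eq_centralBinom m

theorem sum_branches_two (m : ℕ) :
    ∑ τ ∈ treesOf (m + 2), (branches 2 τ : ℝ) = m.centralBinom := by
  induction m with
  | zero => simp [treesOf_two, branches, ord]
  | succ m ih =>
    rw [sum_branches_two_succ, ih]
    refine mul_left_cancel₀ (by positivity : (m : ℝ) + 1 ≠ 0) ?_
    linear_combination -cast_succ_mul_centralBinom_succ m - 2 * cast_succ_mul_catalan m

theorem sum_branches_two_falling (m : ℕ) :
    ∑ τ ∈ treesOf (m + 4), (branches 2 τ * (branches 2 τ - 1) : ℝ) =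
      2 * (2 * m + 1) * m.centralBinom := by
  induction m with
  | zero =>
    rw [sum_branches_two_falling_succ, sum_branches_two_falling_succ,
      sum_branches_two 0]
    simp [treesOf_two, treesOf, branches, ord]
  | succ m ih =>
    rw [show m + 1 + 4 = (m + 3) + 2 from rfl, sum_branches_two_falling_succ, ih,
      sum_branches_two (m + 1)]
    push_cast
    linear_combination -4 * cast_succ_mul_centralBinom_succ m

end

/-- Exact first and second central moments of `S_{2,n}`: for `n ≥ 2`,
`⟨S_{2,n} − n/4⟩ = n/(4(2n−3))`, and for `n ≥ 4`,
`⟨(S_{2,n} − n/4)²⟩ = n(4n²−17n+16)/(16(2n−3)(2n−5))`. -/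
theorem exact_central_moments_S2 :
    (∀ n : ℕ, 2 ≤ n →
      expect n (fun τ => (BinTree.branches 2 τ : ℝ) - (n : ℝ) / 4)
        = (n : ℝ) / (4 * (2 * (n : ℝ) - 3))) ∧
    (∀ n : ℕ, 4 ≤ n →
      expect n (fun τ => ((BinTree.branches 2 τ : ℝ) - (n : ℝ) / 4) ^ 2)
        = (n : ℝ) * (4*(n : ℝ)^2 - 17*(n : ℝ) + 16)
            / (16 * (2 * (n : ℝ) - 3) * (2 * (n : ℝ) - 5))) := by
  constructor
  · intro n hn
    obtain ⟨m, rfl⟩ := Nat.exists_eq_add_of_le' hn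
    have hc := cast_succ_mul_catalan (m + 1)
    have h1 := cast_succ_mul_centralBinom_succ m
    have hb : (0 : ℝ) < (m + 1).centralBinom := by exact_mod_cast Nat.centralBinom_pos _
    have hpos : (0 : ℝ) < catalan (m + 1) :=
      pos_of_mul_pos_right (hc ▸ hb) (by positivity)
    have hd : 2 * ((m : ℝ) + 2) - 3 = 2 * m + 1 := by ring
    rw [expect, Finset.sum_sub_distrib, sum_branches_two, Finset.sum_const, card_treesOf_succ, nsmul_eq_mul]
    push_cast at hc ⊢
    rw [hd, div_eq_div_iff hpos.ne' (by positivity)]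
    rw [← hc] at h1
    linear_combination -2 * h1
  · intro n hn
    obtain ⟨m, rfl⟩ := Nat.exists_eq_add_of_le' hn
    have hc := cast_succ_mul_catalan (m + 3)
    have h1 := cast_succ_mul_centralBinom_succ m
    have h2 := cast_succ_mul_centralBinom_succ (m + 1)
    have h3 := cast_succ_mul_centralBinom_succ (m + 2)
    have hb : (0 : ℝ) < (m + 3).centralBinom := by exact_mod_cast Nat.centralBinom_pos _
    have hpos : (0 : ℝ) < catalan (m + 3) :=
      pos_of_mul_pos_right (hc ▸ hb) (by positivity)
    have hsum : ∑ τ ∈ treesOf (m + 4),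
        ((BinTree.branches 2 τ : ℝ) - ((m + 4 : ℕ) : ℝ) / 4) ^ 2 =
        2 * (2 * m + 1) * m.centralBinom +
          (1 - ((m + 4 : ℕ) : ℝ) / 2) * (m + 2).centralBinom +
          (((m + 4 : ℕ) : ℝ) / 4) ^ 2 * catalan (m + 3) := by
      rw [← sum_branches_two_falling, ← sum_branches_two (m + 2), Finset.mul_sum, ← card_treesOf_succ,
        mul_comm _ (Finset.card _ : ℝ), ← nsmul_eq_mul, ← Finset.sum_const, ← Finset.sum_add_distrib,
        ← Finset.sum_add_distrib]
      exact Finset.sum_congr rfl fun τ _ => by ring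
    rw [expect, hsum, card_treesOf_succ]
    push_cast at hc h1 h2 h3 ⊢
    have hd : 2 * ((m : ℝ) + 4) - 3 = 2 * m + 5 := by ring
    have hd' : 2 * ((m : ℝ) + 4) - 5 = 2 * m + 3 := by ring
    rw [hd, hd', div_eq_div_iff hpos.ne' (by positivity)]
    have e1 : 2 * (2 * (m : ℝ) + 1) * m.centralBinom = (m + 1) * (m + 1).centralBinom := h1.symm
    have e2 : ((m + 1).centralBinom : ℝ) =
        (m + 2) * (m + 2).centralBinom / (2 * (2 * m + 3)) := by
      field_simp
      linear_combination -h2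
    have e3 : ((m + 2).centralBinom : ℝ) =
        (m + 3) * (m + 4) * catalan (m + 3) / (2 * (2 * m + 5)) := by
      field_simp
      rw [← hc] at h3
      linear_combination -h3
    rw [e1, e2, e3]
    field_simp
    ring
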